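/- arXiv:1709.04705 — 8 statements merged into one kernel-verified Lean document; each statement's English description precedes it below -/
import Mathlib

section
/- Let A be a commutative ℝ-algebra equipped with two Poisson brackets {·,·}_0 and {·,·}_1 (each ℝ-bilinear, antisymmetric, satisfying the Jacobi identity and the Leibniz rule {f, g·h} = {f,g}·h + g·{f,h}). Suppose (h_k)_{k∈ℕ} is a sequence in A satisfying the Lenard–Magri recursion relations {f, h_{k+1}}_0 = {f, h_k}_1 for all f ∈ A and all k ∈ ℕ. Then the functions of the hierarchy are in involution with respect to every bracket of the pencil: for all j, k ∈ ℕ, {h_j, h_k}_0 = 0, {h_j, h_k}_1 = 0, and hence {h_j, h_k}_1 − λ·{h_j, h_k}_0 = 0 for every λ ∈ ℝ. -/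
/-- An antisymmetric bilinear map on a real vector space is alternating. -/
theorem LinearMap.apply_self_eq_zero_of_antisymm {M N : Type*} [AddCommGroup M] [Module ℝ M]
    [AddCommGroup N] [Module ℝ N] {B : M →ₗ[ℝ] M →ₗ[ℝ] N} (hB : ∀ f g : M, B f g = -B g f)
    (f : M) : B f f = 0 := by
  have key : (2 : ℝ) • B f f = 0 := by
    rw [two_smul]
    exact eq_neg_iff_add_eq_zero.mp (hB f f)
  exact (smul_eq_zero.mp key).resolve_left two_ne_zero

/-- Members of a sequence satisfying the Lenard–Magri recursion for two antisymmetric bilinear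
maps are in involution with respect to the first one. -/
theorem LinearMap.apply_eq_zero_of_lenardMagri {M N : Type*} [AddCommGroup M] [Module ℝ M]
    [AddCommGroup N] [Module ℝ N] {B0 B1 : M →ₗ[ℝ] M →ₗ[ℝ] N}
    (hanti0 : ∀ f g : M, B0 f g = -B0 g f) (hanti1 : ∀ f g : M, B1 f g = -B1 g f)
    {h : ℕ → M} (hLM : ∀ (f : M) (k : ℕ), B0 f (h (k + 1)) = B1 f (h k)) (j k : ℕ) :
    B0 (h j) (h k) = 0 := by
  have shift : ∀ j k, B0 (h j) (h (k + 1)) = B0 (h (j + 1)) (h k) := fun j k => by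
    rw [hLM, hanti1, ← hLM, ← hanti0]
  have add_right : ∀ n j, B0 (h j) (h (j + n)) = 0 := fun n => by
    induction n using Nat.twoStepInduction with
    | zero => exact fun j => apply_self_eq_zero_of_antisymm hanti0 _
    | one => exact fun j => (hLM _ j).trans (apply_self_eq_zero_of_antisymm hanti1 _)
    | more n ih _ =>
      intro j
      rw [show j + (n + 2) = j + 1 + n + 1 by ring, shift]
      exact ih (j + 1)
  rcases le_total j k with hjk | hkj
  · obtain ⟨n, rfl⟩ := Nat.exists_eq_add_of_le hjk
    exact add_right n j
  · obtain ⟨n, rfl⟩ := Nat.exists_eq_add_of_le hkj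
    rw [hanti0, add_right, neg_zero]

/-- The members of a bi-Hamiltonian hierarchy (a sequence satisfying the
Lenard–Magri recursion relations for a pair of Poisson brackets on a commutative ℝ-algebra)
are in involution with respect to both brackets, hence with respect to every bracket of the
pencil. -/
theorem hierarchy_in_involution {A : Type*} [CommRing A] [Algebra ℝ A]
    (B0 B1 : A →ₗ[ℝ] A →ₗ[ℝ] A)
    (hanti0 : ∀ f g : A, B0 f g = - B0 g f)
    (hjac0 : ∀ f g h : A, B0 f (B0 g h) = B0 (B0 f g) h + B0 g (B0 f h))
    (hleib0 : ∀ f g h : A, B0 f (g * h) = B0 f g * h + g * B0 f h)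
    (hanti1 : ∀ f g : A, B1 f g = - B1 g f)
    (hjac1 : ∀ f g h : A, B1 f (B1 g h) = B1 (B1 f g) h + B1 g (B1 f h))
    (hleib1 : ∀ f g h : A, B1 f (g * h) = B1 f g * h + g * B1 f h)
    (h : ℕ → A)
    (hLM : ∀ (f : A) (k : ℕ), B0 f (h (k + 1)) = B1 f (h k)) :
    ∀ j k : ℕ, B0 (h j) (h k) = 0 ∧ B1 (h j) (h k) = 0 ∧
      ∀ l : ℝ, B1 (h j) (h k) - l • B0 (h j) (h k) = 0 := by
  have inv0 := LinearMap.apply_eq_zero_of_lenardMagri hanti0 hanti1 hLM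
  intro j k
  have inv1 : B1 (h j) (h k) = 0 := by rw [← hLM, inv0]
  exact ⟨inv0 j k, inv1, fun l => by rw [inv0, inv1, smul_zero, sub_zero]⟩
end

section
/- Let A be a commutative ℝ-algebra equipped with two Poisson brackets {·,·}_0 and {·,·}_1 (each ℝ-bilinear, antisymmetric, satisfying the Jacobi identity and the Leibniz rule). Let (g_k)_{k∈ℕ} and (h_k)_{k∈ℕ} be two sequences in A each satisfying the Lenard–Magri recursion relations ({f, g_{k+1}}_0 = {f, g_k}_1 and {f, h_{k+1}}_0 = {f, h_k}_1 for all f ∈ A, k ∈ ℕ), and assume g_0 is a Casimir of {·,·}_0, i.e. {f, g_0}_0 = 0 for all f ∈ A. Then all members of the two hierarchies are in bi-involution: for all j, k ∈ ℕ, {g_j, h_k}_0 = 0 and {g_j, h_k}_1 = 0. -/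
/-- If two bi-Hamiltonian hierarchies are given for a pair of Poisson
brackets on a commutative ℝ-algebra, and one of them starts from a Casimir of the first
bracket, then all members of the two hierarchies are in bi-involution. -/
theorem two_hierarchies_bi_involution {A : Type*} [CommRing A] [Algebra ℝ A]
    (B0 B1 : A →ₗ[ℝ] A →ₗ[ℝ] A)
    (hanti0 : ∀ f g : A, B0 f g = - B0 g f)
    (hjac0 : ∀ f g h : A, B0 f (B0 g h) = B0 (B0 f g) h + B0 g (B0 f h))
    (hleib0 : ∀ f g h : A, B0 f (g * h) = B0 f g * h + g * B0 f h)
    (hanti1 : ∀ f g : A, B1 f g = - B1 g f)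
    (hjac1 : ∀ f g h : A, B1 f (B1 g h) = B1 (B1 f g) h + B1 g (B1 f h))
    (hleib1 : ∀ f g h : A, B1 f (g * h) = B1 f g * h + g * B1 f h)
    (g h : ℕ → A)
    (hLMg : ∀ (f : A) (k : ℕ), B0 f (g (k + 1)) = B1 f (g k))
    (hLMh : ∀ (f : A) (k : ℕ), B0 f (h (k + 1)) = B1 f (h k))
    (hCasimir : ∀ f : A, B0 f (g 0) = 0) :
    ∀ j k : ℕ, B0 (g j) (h k) = 0 ∧ B1 (g j) (h k) = 0 := by
  have h_inv : ∀ j k : ℕ, B0 (g j) (h k) = 0 := by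
    intro j
    induction j with
    | zero => intro k; rw [hanti0, hCasimir, neg_zero]
    | succ j ih => intro k; rw [hanti0, hLMg, ← hanti1, ← hLMh, ih]
  exact fun j k => ⟨h_inv j k, by rw [← hLMh, h_inv]⟩
end

section
/- On ℝ^6 with coordinates (x_1,x_2,x_3,y_1,y_2,y_3), the bracket {f,g}_1 defined by the matrix Π_1 satisfies the Jacobi identity: for all smooth f, g, h : ℝ^6 → ℝ, {f,{g,h}_1}_1 + {g,{h,f}_1}_1 + {h,{f,g}_1}_1 = 0 (so Π_1 is a Poisson tensor on ℝ^6). -/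
open Matrix

/-- The bracket `{f,g}_Π(p) = Σ_{i,j} Π(p)_{ij} ∂f/∂u_i(p) ∂g/∂u_j(p)` on `ℝ^n` associated
to a matrix-valued function `P`. -/
noncomputable def mbracket {n : ℕ} (P : (Fin n → ℝ) → Matrix (Fin n) (Fin n) ℝ)
    (f g : (Fin n → ℝ) → ℝ) (p : Fin n → ℝ) : ℝ :=
  ∑ i, ∑ j, P p i j * fderiv ℝ f p (Pi.single i 1) * fderiv ℝ g p (Pi.single j 1)

/-- The `i`-th component of the Hamiltonian vector field of `h` with respect to `P`. -/
noncomputable def hamVF {n : ℕ} (P : (Fin n → ℝ) → Matrix (Fin n) (Fin n) ℝ)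
    (h : (Fin n → ℝ) → ℝ) (p : Fin n → ℝ) (i : Fin n) : ℝ :=
  ∑ j, P p i j * fderiv ℝ h p (Pi.single j 1)

/-- The Lie–Poisson tensor `Π_0` of `e(3)` on `ℝ^6`, in coordinates
`(x_1,x_2,x_3,y_1,y_2,y_3) = (p 0, …, p 5)`. -/
noncomputable def Pi0 (p : Fin 6 → ℝ) : Matrix (Fin 6) (Fin 6) ℝ :=
  !![0,     0,     0,     0,     -p 2,  p 1;
     0,     0,     0,     p 2,   0,     -p 0;
     0,     0,     0,     -p 1,  p 0,   0;
     0,     -p 2,  p 1,   0,     -p 5,  p 4;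
     p 2,   0,     -p 0,  p 5,   0,     -p 3;
     -p 1,  p 0,   0,     -p 4,  p 3,   0]

/-- The second Poisson tensor `Π_1` on `ℝ^6` for the spherical Lagrange top
(`l_3 = 1`, `m_3 = 2`). -/
noncomputable def Pi1 (p : Fin 6 → ℝ) : Matrix (Fin 6) (Fin 6) ℝ :=
  !![0,        p 5 / 2,  -p 4 / 2, 0,   1, 0;
     -p 5 / 2, 0,        p 3 / 2,  -1,  0, 0;
     p 4 / 2,  -p 3 / 2, 0,        0,   0, 0;
     0,        1,        0,        0,   0, 0;
     -1,       0,        0,        0,   0, 0;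
     0,        0,        0,        0,   0, 0]

open Finset in
/-- The Leibniz rule for the derivative of a bracket. -/
theorem fderiv_mbracket {n : ℕ} {P : (Fin n → ℝ) → Matrix (Fin n) (Fin n) ℝ}
    {g h : (Fin n → ℝ) → ℝ} {p : Fin n → ℝ}
    (hP : ∀ i j, DifferentiableAt ℝ (fun q => P q i j) p)
    (hg : ContDiffAt ℝ 2 g p) (hh : ContDiffAt ℝ 2 h p) (v : Fin n → ℝ) :
    fderiv ℝ (mbracket P g h) p v =
      (∑ i, ∑ j, fderiv ℝ (fun q => P q i j) p v *
          fderiv ℝ g p (Pi.single i 1) * fderiv ℝ h p (Pi.single j 1))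
        + (∑ i, ∑ j, P p i j * fderiv ℝ (fderiv ℝ g) p v (Pi.single i 1) *
          fderiv ℝ h p (Pi.single j 1))
        + ∑ i, ∑ j, P p i j * fderiv ℝ g p (Pi.single i 1) *
          fderiv ℝ (fderiv ℝ h) p v (Pi.single j 1) := by
  have partial_deriv {k : (Fin n → ℝ) → ℝ} (hk : ContDiffAt ℝ 2 k p) (w : Fin n → ℝ) :
      HasFDerivAt (fun q => fderiv ℝ k q w) ((fderiv ℝ (fderiv ℝ k) p).flip w) p := by
    have hd : DifferentiableAt ℝ (fderiv ℝ k) p :=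
      (hk.fderiv_right (m := 1) (by norm_num)).differentiableAt (by norm_num)
    simpa using hd.hasFDerivAt.clm_apply (hasFDerivAt_const w p)
  have key := HasFDerivAt.fun_sum (u := univ) fun i _ => HasFDerivAt.fun_sum (u := univ) fun j _ =>
    ((hP i j).hasFDerivAt.mul (partial_deriv hg (Pi.single i 1))).mul
      (partial_deriv hh (Pi.single j 1))
  have hfd : fderiv ℝ (mbracket P g h) p = _ := HasFDerivAt.fderiv key
  rw [hfd]
  simp only [_root_.sum_apply, _root_.add_apply,
    _root_.smul_apply, ContinuousLinearMap.flip_apply, smul_eq_mul,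
    ← sum_add_distrib, Pi.mul_apply]
  refine sum_congr rfl fun i _ => sum_congr rfl fun j _ => ?_
  ring

open Finset in
theorem sum_rotate {ι M : Type*} [Fintype ι] [AddCommMonoid M] (T : ι → ι → ι → M) :
    ∑ a, ∑ i, ∑ j, T a i j = ∑ i, ∑ j, ∑ a, T a i j := by
  rw [sum_comm]
  exact sum_congr rfl fun i _ => sum_comm

open Finset in
/-- The terms of the Jacobi identity of a skew-symmetric bracket that involve the second
derivatives of a given function cancel in pairs. -/
theorem sum_skew_hessian_comm {n : ℕ} {A H : Matrix (Fin n) (Fin n) ℝ}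
    (hA : ∀ i j, A i j = -A j i) (hH : ∀ i j, H i j = H j i) (f g : Fin n → ℝ) :
    ∑ a, ∑ b, A a b * f a * ∑ i, ∑ j, A i j * g i * H b j
      + ∑ a, ∑ b, A a b * g a * ∑ i, ∑ j, A i j * H b i * f j = 0 := by
  have hswap : ∑ a, ∑ b, A a b * g a * ∑ i, ∑ j, A i j * H b i * f j
      = ∑ a, ∑ b, ∑ i, ∑ j, A i j * g i * (A b a * H j b * f a) := by
    simp only [mul_sum]
    symm
    simp only [sum_rotate fun b i j => A i j * g i * (A b _ * H j b * f _)]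
    rw [sum_rotate]
    exact sum_congr rfl fun _ _ => sum_congr rfl fun _ _ => sum_comm
  rw [hswap]
  simp only [mul_sum, ← sum_add_distrib]
  refine sum_eq_zero fun a _ => sum_eq_zero fun b _ => sum_eq_zero fun i _ =>
    sum_eq_zero fun j _ => ?_
  rw [hA b a, hH j b]
  ring

open Finset in
/-- A skew-symmetric tensor whose Schouten bracket with itself vanishes at a point satisfies the
Jacobi identity at that point. -/
theorem mbracket_jacobi {n : ℕ} {P : (Fin n → ℝ) → Matrix (Fin n) (Fin n) ℝ}
    {f g h : (Fin n → ℝ) → ℝ} {p : Fin n → ℝ}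
    (hP : ∀ i j, DifferentiableAt ℝ (fun q => P q i j) p)
    (hskew : ∀ i j, P p i j = -P p j i)
    (hschouten : ∀ i j k, fderiv ℝ (fun q => P q j k) p (P p i)
      + fderiv ℝ (fun q => P q k i) p (P p j) + fderiv ℝ (fun q => P q i j) p (P p k) = 0)
    (hf : ContDiffAt ℝ 2 f p) (hg : ContDiffAt ℝ 2 g p) (hh : ContDiffAt ℝ 2 h p) :
    mbracket P f (mbracket P g h) p + mbracket P g (mbracket P h f) p
      + mbracket P h (mbracket P f g) p = 0 := by
  have hsymm {k : (Fin n → ℝ) → ℝ} (hk : ContDiffAt ℝ 2 k p) (i j : Fin n) :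
      fderiv ℝ (fderiv ℝ k) p (Pi.single i 1) (Pi.single j 1)
        = fderiv ℝ (fderiv ℝ k) p (Pi.single j 1) (Pi.single i 1) :=
    (hk.isSymmSndFDerivAt (by simp)).eq _ _
  have cancel {k : (Fin n → ℝ) → ℝ} (hk : ContDiffAt ℝ 2 k p) :=
    sum_skew_hessian_comm (A := P p) (H := fun i j =>
      fderiv ℝ (fderiv ℝ k) p (Pi.single i 1) (Pi.single j 1)) hskew (hsymm hk)
  have cf := cancel hf (fun i => fderiv ℝ g p (Pi.single i 1))
    (fun i => fderiv ℝ h p (Pi.single i 1))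
  have cg := cancel hg (fun i => fderiv ℝ h p (Pi.single i 1))
    (fun i => fderiv ℝ f p (Pi.single i 1))
  have ch := cancel hh (fun i => fderiv ℝ f p (Pi.single i 1))
    (fun i => fderiv ℝ g p (Pi.single i 1))
  have expand {u v w : (Fin n → ℝ) → ℝ} (hv : ContDiffAt ℝ 2 v p) (hw : ContDiffAt ℝ 2 w p) :
      mbracket P u (mbracket P v w) p = _ :=
    sum_congr rfl fun a _ => sum_congr rfl fun b _ => by
      rw [fderiv_mbracket hP hv hw, mul_add, mul_add]
  have first_order : ∀ F G H : Fin n → ℝ, ∀ D : Fin n → Fin n → Fin n → ℝ,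
      (∀ i j k, ∑ l, (P p i l * D j k l + P p j l * D k i l + P p k l * D i j l) = 0) →
      ∑ a, ∑ b, P p a b * F a * ∑ i, ∑ j, D i j b * G i * H j
        + ∑ a, ∑ b, P p a b * G a * ∑ i, ∑ j, D i j b * H i * F j
        + ∑ a, ∑ b, P p a b * H a * ∑ i, ∑ j, D i j b * F i * G j = 0 := by
    intro F G H D hD
    have collect (F G H : Fin n → ℝ) :
        ∑ a, ∑ b, P p a b * F a * ∑ i, ∑ j, D i j b * G i * H j
          = ∑ a, ∑ i, ∑ j, F a * G i * H j * ∑ l, P p a l * D i j l := by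
      refine sum_congr rfl fun a _ => ?_
      simp only [mul_sum]
      rw [sum_comm]
      refine sum_congr rfl fun i _ => ?_
      rw [sum_comm]
      refine sum_congr rfl fun j _ => sum_congr rfl fun l _ => ?_
      ring
    have hG := sum_rotate fun a i j => G i * H j * F a * ∑ l, P p i l * D j a l
    have hH := sum_rotate fun j a i => H j * F a * G i * ∑ l, P p j l * D a i l
    rw [collect F G H, collect G H F, collect H F G, ← hG, hH]
    simp only [← sum_add_distrib]
    refine sum_eq_zero fun a _ => sum_eq_zero fun i _ => sum_eq_zero fun j _ => ?_
    have h0 := hD a i j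
    simp only [sum_add_distrib] at h0
    linear_combination F a * G i * H j * h0
  have hbasis (L : (Fin n → ℝ) →L[ℝ] ℝ) (v : Fin n → ℝ) :
      L v = ∑ l, v l * L (Pi.single l 1) := by
    conv_lhs => rw [pi_eq_sum_univ' v, map_sum]
    refine sum_congr rfl fun l _ => ?_
    rw [map_smul, smul_eq_mul]
  have c0 := first_order (fun i => fderiv ℝ f p (Pi.single i 1))
    (fun i => fderiv ℝ g p (Pi.single i 1)) (fun i => fderiv ℝ h p (Pi.single i 1))
    (fun i j l => fderiv ℝ (fun q => P q i j) p (Pi.single l 1)) fun i j k => by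
      simpa only [sum_add_distrib, ← hbasis] using hschouten i j k
  rw [expand hg hh, expand hh hf, expand hf hg]
  simp only [sum_add_distrib]
  linarith

/-- The derivative of the affine tensor `Pi1` is its linear part. -/
theorem exists_hasFDerivAt_Pi1 (p : Fin 6 → ℝ) (i j : Fin 6) :
    ∃ L : (Fin 6 → ℝ) →L[ℝ] ℝ, HasFDerivAt (fun q => Pi1 q i j) L p ∧
      ∀ v, L v = Pi1 v i j - Pi1 0 i j := by
  let L : (Fin 6 → ℝ) →ₗ[ℝ] ℝ :=
    { toFun v := Pi1 v i j - Pi1 0 i j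
      map_add' v w := by fin_cases i <;> fin_cases j <;> simp [Pi1] <;> ring
      map_smul' c v := by fin_cases i <;> fin_cases j <;> simp [Pi1] <;> ring }
  refine ⟨L.toContinuousLinearMap, ?_, fun v => rfl⟩
  refine (L.toContinuousLinearMap.hasFDerivAt.add_const (Pi1 0 i j)).congr_of_eventuallyEq
    (.of_forall fun q => ?_)
  exact (sub_add_cancel (Pi1 q i j) (Pi1 0 i j)).symm

set_option maxHeartbeats 2000000 in
/-- The Schouten bracket of `Pi1` with itself vanishes. -/
theorem Pi1_schouten (p : Fin 6 → ℝ) (i j k : Fin 6) :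
    Pi1 (Pi1 p i) j k - Pi1 0 j k + (Pi1 (Pi1 p j) k i - Pi1 0 k i)
      + (Pi1 (Pi1 p k) i j - Pi1 0 i j) = 0 := by
  fin_cases i <;> fin_cases j <;> fin_cases k <;> simp [Pi1] <;> norm_num

/-- The bracket defined by `Π_1` satisfies the Jacobi identity, so `Π_1` is
a Poisson tensor on `ℝ^6`. -/
theorem Pi1_Jacobi (f g h : (Fin 6 → ℝ) → ℝ)
    (hf : ContDiff ℝ (⊤ : ℕ∞) f) (hg : ContDiff ℝ (⊤ : ℕ∞) g) (hh : ContDiff ℝ (⊤ : ℕ∞) h) :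
    ∀ p : Fin 6 → ℝ,
      mbracket Pi1 f (mbracket Pi1 g h) p + mbracket Pi1 g (mbracket Pi1 h f) p
        + mbracket Pi1 h (mbracket Pi1 f g) p = 0 := by
  intro p
  have hd i j : DifferentiableAt ℝ (fun q => Pi1 q i j) p :=
    let ⟨_, hL, _⟩ := exists_hasFDerivAt_Pi1 p i j
    hL.differentiableAt
  have hv i j v : fderiv ℝ (fun q => Pi1 q i j) p v = Pi1 v i j - Pi1 0 i j := by
    obtain ⟨L, hL, hLv⟩ := exists_hasFDerivAt_Pi1 p i j
    rw [hL.fderiv, hLv]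
  have h2 : (2 : WithTop ℕ∞) ≤ ((⊤ : ℕ∞) : WithTop ℕ∞) := WithTop.coe_le_coe.mpr le_top
  refine mbracket_jacobi hd (fun i j => ?_) (fun i j k => ?_) (hf.of_le h2).contDiffAt
    (hg.of_le h2).contDiffAt (hh.of_le h2).contDiffAt
  · fin_cases i <;> fin_cases j <;> simp [Pi1] <;> ring
  · simpa only [hv] using Pi1_schouten p i j k
end

section
/- On ℝ^6, the functions f_3 = (1/2)(y_1² + y_2² + y_3²) + 2x_3 and f_4 = y_3 are Casimir invariants of the bracket {·,·}_1 defined by Π_1: for every smooth g : ℝ^6 → ℝ, the functions {f_3, g}_1 and {f_4, g}_1 vanish identically on ℝ^6. -/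
open Matrix

theorem hasFDerivAt_coord {n : ℕ} (i : Fin n) (p : Fin n → ℝ) :
    HasFDerivAt (fun q : Fin n → ℝ => q i)
      (ContinuousLinearMap.proj i : (Fin n → ℝ) →L[ℝ] ℝ) p :=
  (ContinuousLinearMap.proj i : (Fin n → ℝ) →L[ℝ] ℝ).hasFDerivAt

theorem fderiv_coord_apply {n : ℕ} (i : Fin n) (p v : Fin n → ℝ) :
    fderiv ℝ (fun q : Fin n → ℝ => q i) p v = v i := by
  rw [(hasFDerivAt_coord i p).fderiv, ContinuousLinearMap.proj_apply]

theorem fderiv_half_sq_add_two_mul_apply (p v : Fin 6 → ℝ) :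
    fderiv ℝ (fun q : Fin 6 → ℝ =>
        (1 / 2) * (q 3 ^ 2 + q 4 ^ 2 + q 5 ^ 2) + 2 * q 2) p v =
      p 3 * v 3 + p 4 * v 4 + p 5 * v 5 + 2 * v 2 := by
  have h := (((((hasFDerivAt_coord 3 p).pow 2).add ((hasFDerivAt_coord 4 p).pow 2)).add
    ((hasFDerivAt_coord 5 p).pow 2)).const_mul (1 / 2 : ℝ)).add
    ((hasFDerivAt_coord 2 p).const_mul (2 : ℝ))
  refine (DFunLike.congr_fun h.fderiv v).trans ?_
  simp
  ring

/-- The functions `f_3 = (1/2)(y_1² + y_2² + y_3²) + 2x_3` and `f_4 = y_3`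
are Casimir invariants of the bracket defined by `Π_1`. -/
theorem Pi1_Casimirs (g : (Fin 6 → ℝ) → ℝ) (hg : ContDiff ℝ (⊤ : ℕ∞) g) :
    ∀ p : Fin 6 → ℝ,
      mbracket Pi1 (fun q => (1 / 2) * (q 3 ^ 2 + q 4 ^ 2 + q 5 ^ 2) + 2 * q 2) g p = 0 ∧
      mbracket Pi1 (fun q => q 5) g p = 0 := by
  intro p
  constructor
  · simp only [mbracket, fderiv_half_sq_add_two_mul_apply]
    simp [Fin.sum_univ_six, Pi1, Pi.single_apply]
  · simp only [mbracket, fderiv_coord_apply]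
    simp [Fin.sum_univ_six, Pi1, Pi.single_apply]
end

section
/- The constants of motion of the spherical Lagrange top (l_3 = 1, m_3 = 2), namely f_1 = x_1² + x_2² + x_3², f_2 = x_1y_1 + x_2y_2 + x_3y_3, f_3 = (1/2)(y_1² + y_2² + y_3²) + 2x_3, f_4 = y_3, are pairwise in involution with respect to both Poisson brackets on ℝ^6: for all i, j ∈ {1,2,3,4}, {f_i, f_j}_0 = 0 and {f_i, f_j}_1 = 0 identically on ℝ^6 (hence {f_i,f_j}_1 − λ{f_i,f_j}_0 = 0 for every λ ∈ ℝ). -/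
open Matrix

/-- The four constants of motion of the spherical Lagrange top (`l_3 = 1`, `m_3 = 2`). -/
noncomputable def lagrangeF : Fin 4 → (Fin 6 → ℝ) → ℝ :=
  ![fun q => q 0 ^ 2 + q 1 ^ 2 + q 2 ^ 2,
    fun q => q 0 * q 3 + q 1 * q 4 + q 2 * q 5,
    fun q => (1 / 2) * (q 3 ^ 2 + q 4 ^ 2 + q 5 ^ 2) + 2 * q 2,
    fun q => q 5]

/-- The Jacobian matrix of `lagrangeF`: its `i`-th row is the gradient of `lagrangeF i`. -/
noncomputable def lagrangeJacobian (p : Fin 6 → ℝ) : Matrix (Fin 4) (Fin 6) ℝ :=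
  !![2 * p 0, 2 * p 1, 2 * p 2, 0,   0,   0;
     p 3,     p 4,     p 5,     p 0, p 1, p 2;
     0,       0,       2,       p 3, p 4, p 5;
     0,       0,       0,       0,   0,   1]

theorem fderiv_lagrangeF_single (i : Fin 4) (p : Fin 6 → ℝ) (k : Fin 6) :
    fderiv ℝ (lagrangeF i) p (Pi.single k 1) = lagrangeJacobian p i k := by
  have h (a : Fin 6) : HasFDerivAt (fun q : Fin 6 → ℝ => q a)
      (ContinuousLinearMap.proj (R := ℝ) (φ := fun _ : Fin 6 => ℝ) a) p :=
    hasFDerivAt_apply a p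
  have h₁ := ((h 0).pow 2).add ((h 1).pow 2) |>.add ((h 2).pow 2)
  have h₂ := ((h 0).mul (h 3)).add ((h 1).mul (h 4)) |>.add ((h 2).mul (h 5))
  have h₃ := ((((h 3).pow 2).add ((h 4).pow 2) |>.add ((h 5).pow 2)).const_mul (1 / 2)).add
    ((h 2).const_mul 2)
  fin_cases i
  · refine (congrArg (fun L => L (Pi.single k 1)) h₁.fderiv).trans ?_
    fin_cases k <;> simp [lagrangeJacobian]
  · refine (congrArg (fun L => L (Pi.single k 1)) h₂.fderiv).trans ?_
    fin_cases k <;> simp [lagrangeJacobian]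
  · refine (congrArg (fun L => L (Pi.single k 1)) h₃.fderiv).trans ?_
    fin_cases k <;> simp [lagrangeJacobian]
  · refine (congrArg (fun L => L (Pi.single k 1)) (h 5).fderiv).trans ?_
    fin_cases k <;> simp [lagrangeJacobian]

theorem mbracket_Pi0_lagrangeF (i j : Fin 4) (p : Fin 6 → ℝ) :
    mbracket Pi0 (lagrangeF i) (lagrangeF j) p = 0 := by
  simp only [mbracket, fderiv_lagrangeF_single]
  fin_cases i <;> fin_cases j <;>
    simp [Fin.sum_univ_six, Pi0, lagrangeJacobian] <;> ring

theorem mbracket_Pi1_lagrangeF (i j : Fin 4) (p : Fin 6 → ℝ) :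
    mbracket Pi1 (lagrangeF i) (lagrangeF j) p = 0 := by
  simp only [mbracket, fderiv_lagrangeF_single]
  fin_cases i <;> fin_cases j <;>
    simp [Fin.sum_univ_six, Pi1, lagrangeJacobian] <;> ring

/-- The constants of motion `f_1, f_2, f_3, f_4` of the spherical Lagrange
top are pairwise in involution with respect to both Poisson brackets on `ℝ^6`, hence with
respect to every bracket of the pencil. -/
theorem lagrangeF_involutive :
    ∀ (i j : Fin 4) (p : Fin 6 → ℝ),
      mbracket Pi0 (lagrangeF i) (lagrangeF j) p = 0 ∧
      mbracket Pi1 (lagrangeF i) (lagrangeF j) p = 0 ∧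
      ∀ l : ℝ, mbracket Pi1 (lagrangeF i) (lagrangeF j) p
        - l * mbracket Pi0 (lagrangeF i) (lagrangeF j) p = 0 := by
  intro i j p
  simp [mbracket_Pi0_lagrangeF, mbracket_Pi1_lagrangeF]
end

section
/- For the spherical Lagrange top (l_3 = 1, m_3 = 2), the equations of motion are also Hamiltonian with respect to Π_1 with Hamiltonian f_1 = x_1² + x_2² + x_3²: for every p ∈ ℝ^6 and every i = 1,…,6, the i-th component Σ_{j=1}^{6} (Π_1)_{ij}(p)·(∂f_1/∂u_j)(p) equals the i-th component of the vector field (y_3x_2 − y_2x_3, y_1x_3 − y_3x_1, y_2x_1 − y_1x_2, 2x_2, −2x_1, 0) evaluated at p; thus the Lagrange top is a bi-Hamiltonian system for the pair (Π_0, Π_1). -/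
open Matrix

/-- The differential of `q ↦ q 0 ^ 2 + q 1 ^ 2 + q 2 ^ 2` on `ℝ^6`. -/
theorem fderiv_sq_add_sq_add_sq (p v : Fin 6 → ℝ) :
    fderiv ℝ (fun q : Fin 6 → ℝ => q 0 ^ 2 + q 1 ^ 2 + q 2 ^ 2) p v =
      2 * p 0 * v 0 + 2 * p 1 * v 1 + 2 * p 2 * v 2 := by
  have h (k : Fin 6) := (hasFDerivAt_apply (𝕜 := ℝ) k p).pow 2
  have hsum := ((h 0).add (h 1)).add (h 2)
  have hf : fderiv ℝ (fun q : Fin 6 → ℝ => q 0 ^ 2 + q 1 ^ 2 + q 2 ^ 2) p = _ := hsum.fderiv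
  rw [hf]
  simp

/-- For the spherical Lagrange top (`l_3 = 1`, `m_3 = 2`), the equations of
motion are also Hamiltonian with respect to `Π_1` with Hamiltonian
`f_1 = x_1² + x_2² + x_3²`; thus the Lagrange top is bi-Hamiltonian for `(Π_0, Π_1)`. -/
theorem LagrangeTop_Hamiltonian_Pi1 :
    ∀ (p : Fin 6 → ℝ) (i : Fin 6),
      hamVF Pi1 (fun q => q 0 ^ 2 + q 1 ^ 2 + q 2 ^ 2) p i =
        ![p 5 * p 1 - p 4 * p 2,
          p 3 * p 2 - p 5 * p 0,
          p 4 * p 0 - p 3 * p 1,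
          2 * p 1,
          -2 * p 0,
          0] i := by
  intro p i
  simp only [hamVF, fderiv_sq_add_sq_add_sq, Fin.sum_univ_six]
  fin_cases i <;> simp [Pi1] <;> ring
end

section
/- On ℝ^5 with coordinates (a_1,a_2,b_1,b_2,b_3), the bracket {f,g}_0 defined by the matrix Π_0 satisfies the Jacobi identity for all smooth f, g, h : ℝ^5 → ℝ (so Π_0 is a Poisson tensor), and the function f_0 = b_1 + b_2 + b_3 is a Casimir of {·,·}_0: {f_0, g}_0 vanishes identically for every smooth g : ℝ^5 → ℝ. -/
open Matrix

/-- The linear Toda Poisson tensor `Π_0` on `ℝ^5`, in Flaschka coordinates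
`(a_1,a_2,b_1,b_2,b_3) = (p 0, …, p 4)`. -/
noncomputable def TPi0 (p : Fin 5 → ℝ) : Matrix (Fin 5) (Fin 5) ℝ :=
  !![0,     0,    -p 0,  p 0,   0;
     0,     0,    0,     -p 1,  p 1;
     p 0,   0,    0,     0,     0;
     -p 0,  p 1,  0,     0,     0;
     0,     -p 1, 0,     0,     0]

/-- The quadratic (Adler) Toda Poisson tensor `Π_1` on `ℝ^5`. -/
noncomputable def TPi1 (p : Fin 5 → ℝ) : Matrix (Fin 5) (Fin 5) ℝ :=
  !![0,              p 0 * p 1 / 2,  -p 0 * p 2,   p 0 * p 3,    0;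
     -p 0 * p 1 / 2, 0,              0,            -p 1 * p 3,   p 1 * p 4;
     p 0 * p 2,      0,              0,            2 * p 0 ^ 2,  0;
     -p 0 * p 3,     p 1 * p 3,      -2 * p 0 ^ 2, 0,            2 * p 1 ^ 2;
     0,              -p 1 * p 4,     0,            -2 * p 1 ^ 2, 0]

theorem mbracket_TPi0 (f g : (Fin 5 → ℝ) → ℝ) (p : Fin 5 → ℝ) :
    mbracket TPi0 f g p =
      p 0 * (fderiv ℝ f p (Pi.single 0 1) *
            (fderiv ℝ g p (Pi.single 3 1) - fderiv ℝ g p (Pi.single 2 1)) -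
          (fderiv ℝ f p (Pi.single 3 1) - fderiv ℝ f p (Pi.single 2 1)) *
            fderiv ℝ g p (Pi.single 0 1)) +
        p 1 * (fderiv ℝ f p (Pi.single 1 1) *
            (fderiv ℝ g p (Pi.single 4 1) - fderiv ℝ g p (Pi.single 3 1)) -
          (fderiv ℝ f p (Pi.single 4 1) - fderiv ℝ f p (Pi.single 3 1)) *
            fderiv ℝ g p (Pi.single 1 1)) := by
  simp [mbracket, TPi0, Fin.sum_univ_five]
  ring

theorem hasFDerivAt_fderiv_apply {E : Type*} [NormedAddCommGroup E] [NormedSpace ℝ E] {f : E → ℝ}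
    (hf : ContDiff ℝ 2 f) (p v : E) :
    HasFDerivAt (fun q => fderiv ℝ f q v) (fderiv ℝ (fderiv ℝ f) p v) p := by
  have hd : DifferentiableAt ℝ (fderiv ℝ f) p :=
    ((hf.fderiv_right (m := 1) (by norm_num)).differentiable (by norm_num)) p
  have hsymm : IsSymmSndFDerivAt ℝ f p :=
    hf.contDiffAt.isSymmSndFDerivAt (by simp)
  refine (hd.hasFDerivAt.clm_apply (hasFDerivAt_const v p)).congr_fderiv ?_
  ext w
  simpa using hsymm.eq w v

theorem fderiv_mbracket_TPi0_apply {f g : (Fin 5 → ℝ) → ℝ} (hf : ContDiff ℝ 2 f)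
    (hg : ContDiff ℝ 2 g) (p v : Fin 5 → ℝ) :
    let Df (i : Fin 5) := fderiv ℝ f p (Pi.single i 1)
    let Dg (i : Fin 5) := fderiv ℝ g p (Pi.single i 1)
    let D2f (i : Fin 5) := fderiv ℝ (fderiv ℝ f) p (Pi.single i 1) v
    let D2g (i : Fin 5) := fderiv ℝ (fderiv ℝ g) p (Pi.single i 1) v
    fderiv ℝ (mbracket TPi0 f g) p v =
      v 0 * (Df 0 * (Dg 3 - Dg 2) - (Df 3 - Df 2) * Dg 0) +
        p 0 * (Df 0 * (D2g 3 - D2g 2) + D2f 0 * (Dg 3 - Dg 2) -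
          ((Df 3 - Df 2) * D2g 0 + (D2f 3 - D2f 2) * Dg 0)) +
        v 1 * (Df 1 * (Dg 4 - Dg 3) - (Df 4 - Df 3) * Dg 1) +
        p 1 * (Df 1 * (D2g 4 - D2g 3) + D2f 1 * (Dg 4 - Dg 3) -
          ((Df 4 - Df 3) * D2g 1 + (D2f 4 - D2f 3) * Dg 1)) := by
  intro Df Dg D2f D2g
  have hF := hasFDerivAt_fderiv_apply hf p
  have hG := hasFDerivAt_fderiv_apply hg p
  have hp (i : Fin 5) := hasFDerivAt_apply (𝕜 := ℝ) i p
  have key :=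
    ((hp 0).mul (((hF (Pi.single 0 1)).mul ((hG (Pi.single 3 1)).sub (hG (Pi.single 2 1)))).sub
      (((hF (Pi.single 3 1)).sub (hF (Pi.single 2 1))).mul (hG (Pi.single 0 1))))).add
    ((hp 1).mul (((hF (Pi.single 1 1)).mul ((hG (Pi.single 4 1)).sub (hG (Pi.single 3 1)))).sub
      (((hF (Pi.single 4 1)).sub (hF (Pi.single 3 1))).mul (hG (Pi.single 1 1)))))
  rw [(key.congr_of_eventuallyEq (.of_forall (mbracket_TPi0 f g))).fderiv]
  simp [Df, Dg, D2f, D2g]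
  ring

/-- The bracket defined by the linear Toda tensor `Π_0` satisfies the
Jacobi identity (so `Π_0` is a Poisson tensor), and `f_0 = b_1 + b_2 + b_3` is a Casimir. -/
theorem TPi0_Jacobi_and_Casimir :
    (∀ f g h : (Fin 5 → ℝ) → ℝ, ContDiff ℝ (⊤ : ℕ∞) f → ContDiff ℝ (⊤ : ℕ∞) g → ContDiff ℝ (⊤ : ℕ∞) h →
      ∀ p : Fin 5 → ℝ,
        mbracket TPi0 f (mbracket TPi0 g h) p + mbracket TPi0 g (mbracket TPi0 h f) p
          + mbracket TPi0 h (mbracket TPi0 f g) p = 0) ∧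
    (∀ g : (Fin 5 → ℝ) → ℝ, ContDiff ℝ (⊤ : ℕ∞) g →
      ∀ p : Fin 5 → ℝ, mbracket TPi0 (fun q => q 2 + q 3 + q 4) g p = 0) := by
  refine ⟨fun f g h hf hg hh p => ?_, fun g _ p => ?_⟩
  · replace hf : ContDiff ℝ 2 f := hf.of_le (WithTop.coe_le_coe.2 le_top)
    replace hg : ContDiff ℝ 2 g := hg.of_le (WithTop.coe_le_coe.2 le_top)
    replace hh : ContDiff ℝ 2 h := hh.of_le (WithTop.coe_le_coe.2 le_top)
    have exists_symm {k : (Fin 5 → ℝ) → ℝ} (hk : ContDiff ℝ 2 k) :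
        ∃ S : Fin 5 → Fin 5 → ℝ, ∀ i j,
          fderiv ℝ (fderiv ℝ k) p (Pi.single i 1) (Pi.single j 1) = S (max i j) (min i j) := by
      have hs : IsSymmSndFDerivAt ℝ k p := hk.contDiffAt.isSymmSndFDerivAt (by simp)
      refine ⟨fun i j => fderiv ℝ (fderiv ℝ k) p (Pi.single i 1) (Pi.single j 1), fun i j => ?_⟩
      rcases le_total i j with hij | hij
      · rw [max_eq_right hij, min_eq_left hij, hs.eq]
      · rw [max_eq_left hij, min_eq_right hij]
    obtain ⟨F, hF⟩ := exists_symm hf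
    obtain ⟨G, hG⟩ := exists_symm hg
    obtain ⟨H, hH⟩ := exists_symm hh
    simp only [mbracket_TPi0 _ (mbracket TPi0 _ _), fderiv_mbracket_TPi0_apply hg hh,
      fderiv_mbracket_TPi0_apply hh hf, fderiv_mbracket_TPi0_apply hf hg]
    simp [hF, hG, hH]
    ring
  · have hf (v : Fin 5 → ℝ) :
        fderiv ℝ (fun q : Fin 5 → ℝ => q 2 + q 3 + q 4) p v = v 2 + v 3 + v 4 := by
      have hp (i : Fin 5) := hasFDerivAt_apply (𝕜 := ℝ) i p
      rw [(((hp 2).fun_add (hp 3)).fun_add (hp 4)).fderiv]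
      simp
    simp [mbracket_TPi0, hf]
end

section
/- On ℝ^5, with f_0 = b_1 + b_2 + b_3, f_1 = a_1² + a_2² − b_1b_2 − b_1b_3 − b_2b_3, f_2 = b_1b_2b_3 − b_1a_2² − b_3a_1², the Lenard–Magri relations hold for the pair (Π_0, Π_1): for every p ∈ ℝ^5 and every i = 1,…,5, Σ_{j=1}^{5} (Π_0)_{ij}(p)·(∂f_1/∂u_j)(p) = Σ_{j=1}^{5} (Π_1)_{ij}(p)·(∂f_0/∂u_j)(p), and this common vector equals the i-th component of the Toda vector field (a_1(b_2−b_1), a_2(b_3−b_2), 2a_1², 2(a_2²−a_1²), −2a_2²) at p; moreover Σ_{j=1}^{5} (Π_0)_{ij}(p)·(∂f_2/∂u_j)(p) = Σ_{j=1}^{5} (Π_1)_{ij}(p)·(∂f_1/∂u_j)(p). In particular the open Toda lattice of 3 particles is a bi-Hamiltonian system, and f_0, f_1, f_2 are pairwise in involution with respect to both brackets. -/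
open Matrix

/-- The Toda first integrals `f_0, f_1, f_2` (coefficients of the characteristic polynomial
of the Lax matrix), in Flaschka coordinates. -/
noncomputable def todaF : Fin 3 → (Fin 5 → ℝ) → ℝ :=
  ![fun q => q 2 + q 3 + q 4,
    fun q => q 0 ^ 2 + q 1 ^ 2 - q 2 * q 3 - q 2 * q 4 - q 3 * q 4,
    fun q => q 2 * q 3 * q 4 - q 2 * q 1 ^ 2 - q 4 * q 0 ^ 2]

/-- The partial derivatives of the Toda first integrals: row `k` is the gradient of `f_k`. -/
noncomputable def todaGrad (p : Fin 5 → ℝ) : Matrix (Fin 3) (Fin 5) ℝ :=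
  !![0, 0, 1, 1, 1;
     2 * p 0, 2 * p 1, -p 3 - p 4, -p 2 - p 4, -p 2 - p 3;
     -2 * p 4 * p 0, -2 * p 2 * p 1, p 3 * p 4 - p 1 ^ 2, p 2 * p 4, p 2 * p 3 - p 0 ^ 2]

theorem fderiv_todaF_single (k : Fin 3) (p : Fin 5 → ℝ) (j : Fin 5) :
    fderiv ℝ (todaF k) p (Pi.single j 1) = todaGrad p k j := by
  have h (i : Fin 5) : HasFDerivAt (fun q : Fin 5 → ℝ => q i)
      (ContinuousLinearMap.proj (R := ℝ) (φ := fun _ : Fin 5 => ℝ) i) p :=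
    hasFDerivAt_apply i p
  have h₀ : HasFDerivAt (todaF 0) _ p := ((h 2).add (h 3)).add (h 4)
  have h₁ : HasFDerivAt (todaF 1) _ p :=
    (((((h 0).pow 2).add ((h 1).pow 2)).sub ((h 2).mul (h 3))).sub ((h 2).mul (h 4))).sub
      ((h 3).mul (h 4))
  have h₂ : HasFDerivAt (todaF 2) _ p :=
    ((((h 2).mul (h 3)).mul (h 4)).sub ((h 2).mul ((h 1).pow 2))).sub
      ((h 4).mul ((h 0).pow 2))
  fin_cases k
  · refine (DFunLike.congr_fun h₀.fderiv _).trans ?_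
    fin_cases j <;> simp [todaGrad]
  · refine (DFunLike.congr_fun h₁.fderiv _).trans ?_
    fin_cases j <;> simp [todaGrad]
  · refine (DFunLike.congr_fun h₂.fderiv _).trans ?_
    fin_cases j <;> simp [todaGrad] <;> ring

/-- The Lenard–Magri relations hold for `(Π_0, Π_1)` and `f_0, f_1, f_2`:
`Π_0^♯(df_1) = Π_1^♯(df_0)` equals the Toda vector field, and `Π_0^♯(df_2) = Π_1^♯(df_1)`.
In particular the open Toda lattice of 3 particles is bi-Hamiltonian and `f_0, f_1, f_2` are
pairwise in involution with respect to both brackets. -/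
theorem Toda_LenardMagri :
    (∀ (p : Fin 5 → ℝ) (i : Fin 5),
      hamVF TPi0 (todaF 1) p i = hamVF TPi1 (todaF 0) p i ∧
      hamVF TPi0 (todaF 1) p i =
        ![p 0 * (p 3 - p 2), p 1 * (p 4 - p 3), 2 * p 0 ^ 2,
          2 * (p 1 ^ 2 - p 0 ^ 2), -2 * p 1 ^ 2] i ∧
      hamVF TPi0 (todaF 2) p i = hamVF TPi1 (todaF 1) p i) ∧
    (∀ (i j : Fin 3) (p : Fin 5 → ℝ),
      mbracket TPi0 (todaF i) (todaF j) p = 0 ∧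
      mbracket TPi1 (todaF i) (todaF j) p = 0) := by
  refine ⟨fun p i => ?_, fun i j p => ?_⟩
  · simp only [hamVF, fderiv_todaF_single]
    fin_cases i <;> refine ⟨?_, ?_, ?_⟩ <;>
      simp [Fin.sum_univ_five, todaGrad, TPi0, TPi1] <;> ring
  · simp only [mbracket, fderiv_todaF_single]
    fin_cases i <;> fin_cases j <;> constructor <;>
      simp [Fin.sum_univ_five, todaGrad, TPi0, TPi1] <;> ring
end
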